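/- Let L be a commutative incline, i.e., L carries a SemilatticeSup structure and a CommSemigroup multiplication satisfying x*(y ⊔ z) = x*y ⊔ x*z and x ⊔ x*y = x for all x, y, z ∈ L. For a matrix A : Fin 3 → Fin 3 → L with powers defined entrywise by (A^m)_{ij} = the supremum over all walks V : Fin (m+1) → Fin 3 with V 0 = i, V m = j of ∏_{s=0}^{m-1} A (V s) (V (s+1)), the order-period of A is at most 6: there exists a positive integer d ≤ 6 (namely d = 6) and a positive integer k (namely k = 5) such that A^{k+d} ≤ A^k entrywise. -/

import Mathlib

/-- The product of the entries of a matrix `A` along a walk of positive length `l + 1`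
on `Fin n` (a walk of length `l + 1` being a function `Fin (l + 2) → Fin n`). -/
def walkProd {L : Type*} [Mul L] {n : ℕ} (A : Fin n → Fin n → L) :
    {l : ℕ} → (Fin (l + 2) → Fin n) → L
  | 0, V => A (V 0) (V 1)
  | l + 1, V => A (V 0) (V 1) * walkProd A (fun t : Fin (l + 2) => V t.succ)

/-- The `(i, j)` entry of the `(m + 1)`-st power of the matrix `A` over a semilattice:
the (finite, nonempty) supremum, over all walks `V` of length `m + 1` on `Fin 3`
with `V 0 = i` and `V (m + 1) = j`, of the product of the entries of `A` along `V`. -/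
def powEntry {L : Type*} [SemilatticeSup L] [Mul L]
    (A : Fin 3 → Fin 3 → L) (m : ℕ) (i j : Fin 3) : L :=
  Finset.sup'
    (Finset.univ.filter fun V : Fin (m + 2) → Fin 3 => V 0 = i ∧ V (Fin.last (m + 1)) = j)
    ⟨fun t => if t = 0 then i else j, by
      simp only [Finset.mem_filter, Finset.mem_univ, true_and]
      constructor
      · simp
      · rw [if_neg (by simp [Fin.ext_iff])]⟩
    (fun V => walkProd A V)

/-- `IsWalkWeight A l i j w` says that `w` is the product of the entries of `A` along some walk
of length `l` from `i` to `j`; the walk of length zero has weight `1`. -/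
inductive IsWalkWeight {L : Type*} [CommSemigroup L] {n : ℕ} (A : Fin n → Fin n → L) :
    ℕ → Fin n → Fin n → WithOne L → Prop
  | nil (i : Fin n) : IsWalkWeight A 0 i i 1
  | cons {l : ℕ} (i : Fin n) {a j : Fin n} {w : WithOne L} (h : IsWalkWeight A l a j w) :
      IsWalkWeight A (l + 1) i j (A i a * w)

namespace IsWalkWeight

variable {L : Type*} [CommSemigroup L] {n : ℕ} {A : Fin n → Fin n → L}

theorem append {l m : ℕ} {i a j : Fin n} {w v : WithOne L}
    (hw : IsWalkWeight A l i a w) (hv : IsWalkWeight A m a j v) :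
    IsWalkWeight A (l + m) i j (w * v) := by
  induction hw with
  | nil => simpa using hv
  | cons i _ ih =>
    rw [mul_assoc, Nat.add_right_comm]
    exact cons i (ih hv)

theorem exists_append {l m : ℕ} {i j : Fin n} {w : WithOne L}
    (h : IsWalkWeight A (l + m) i j w) :
    ∃ a u v, IsWalkWeight A l i a u ∧ IsWalkWeight A m a j v ∧ w = u * v := by
  induction l generalizing i w with
  | zero => exact ⟨i, 1, w, nil i, by simpa using h, by simp⟩
  | succ l ih =>
    rw [Nat.add_right_comm] at h
    cases h with
    | cons _ h =>
      obtain ⟨a, u, v, hu, hv, rfl⟩ := ih h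
      exact ⟨a, _, v, cons i hu, hv, (mul_assoc _ _ _).symm⟩

theorem of_walkProd {l : ℕ} (V : Fin (l + 2) → Fin n) :
    IsWalkWeight A (l + 1) (V 0) (V (Fin.last (l + 1))) (walkProd A V : L) := by
  induction l with
  | zero => simpa [walkProd] using cons (A := A) (V 0) (nil (V 1))
  | succ l ih =>
    rw [walkProd, WithOne.coe_mul]
    exact cons (V 0) (ih fun t => V t.succ)

theorem exists_walkProd {l : ℕ} {i j : Fin n} {w : WithOne L}
    (h : IsWalkWeight A (l + 1) i j w) :
    ∃ V : Fin (l + 2) → Fin n,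
      V 0 = i ∧ V (Fin.last (l + 1)) = j ∧ (walkProd A V : L) = w := by
  induction l generalizing i w with
  | zero =>
    cases h with
    | cons _ h =>
      cases h
      exact ⟨![i, j], rfl, rfl, by simp [walkProd]⟩
  | succ l ih =>
    cases h with
    | cons _ h =>
      obtain ⟨V, h0, hl, rfl⟩ := ih h
      refine ⟨Fin.cons i V, rfl, hl, ?_⟩
      rw [walkProd, WithOne.coe_mul, ← h0]
      rfl

/-- A walk of length three on three vertices contains a closed subwalk. -/
theorem exists_shorten {A : Fin 3 → Fin 3 → L} {i j : Fin 3} {w : WithOne L}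
    (h : IsWalkWeight A 3 i j w) :
    ∃ l < 3, ∃ v, IsWalkWeight A l i j v ∧ v ∣ w := by
  obtain _ | ⟨_, h⟩ := h
  rename_i a _
  obtain _ | ⟨_, h⟩ := h
  rename_i b _
  obtain _ | ⟨_, h⟩ := h
  cases h
  have hrep : i = j ∨ i = b ∨ a = j ∨ i = a ∨ a = b ∨ b = j := by omega
  rcases hrep with rfl | rfl | rfl | rfl | rfl | rfl
  · exact ⟨0, by lia, _, nil i, one_dvd _⟩
  · exact ⟨1, by lia, _, cons i (nil j), (dvd_mul_left _ _).mul_left _⟩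
  · exact ⟨1, by lia, _, cons i (nil a), mul_dvd_mul_left _ (one_dvd _)⟩
  · exact ⟨2, by lia, _, cons i (cons b (nil j)), dvd_mul_left _ _⟩
  · exact ⟨2, by lia, _, cons i (cons a (nil j)), mul_dvd_mul_left _ (dvd_mul_left _ _)⟩
  · exact ⟨2, by lia, _, cons i (cons a (nil b)),
      mul_dvd_mul_left _ (mul_dvd_mul_left _ (one_dvd _))⟩

/-- A walk of length `3 * N` on three vertices contains `N` disjoint closed subwalks, `a` of length
one, `b` of length two and `c` of length three, any of which can be removed independently. -/
theorem exists_shorten_mul {A : Fin 3 → Fin 3 → L} (N : ℕ) {i j : Fin 3} {w : WithOne L}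
    (h : IsWalkWeight A (3 * N) i j w) :
    ∃ a b c, a + b + c = N ∧ ∀ x ≤ a, ∀ y ≤ b, ∀ z ≤ c, ∃ l v,
      l + (x + 2 * y + 3 * z) = 3 * N ∧ IsWalkWeight A l i j v ∧ v ∣ w := by
  induction N generalizing i w with
  | zero => exact ⟨0, 0, 0, rfl, fun x _ y _ z _ => ⟨0, w, by lia, h, dvd_rfl⟩⟩
  | succ N ih =>
    rw [show 3 * (N + 1) = 3 + 3 * N by ring] at h
    obtain ⟨k, u, v, hu, hv, rfl⟩ := h.exists_append
    obtain ⟨a, b, c, hN, habc⟩ := ih hv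
    obtain ⟨l', hl', u', hu', hdvd⟩ := hu.exists_shorten
    have keep : ∀ x ≤ a, ∀ y ≤ b, ∀ z ≤ c, ∃ l v',
        l + (x + 2 * y + 3 * z) = 3 * (N + 1) ∧ IsWalkWeight A l i j v' ∧ v' ∣ u * v := by
      intro x hx y hy z hz
      obtain ⟨l, v', hl, hv', hd⟩ := habc x hx y hy z hz
      exact ⟨3 + l, _, by lia, hu.append hv', mul_dvd_mul_left _ hd⟩
    have remove : ∀ x ≤ a, ∀ y ≤ b, ∀ z ≤ c, ∃ l v',
        l + (x + 2 * y + 3 * z) = l' + 3 * N ∧ IsWalkWeight A l i j v' ∧ v' ∣ u * v := by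
      intro x hx y hy z hz
      obtain ⟨l, v', hl, hv', hd⟩ := habc x hx y hy z hz
      exact ⟨l' + l, _, by lia, hu'.append hv', mul_dvd_mul hdvd hd⟩
    interval_cases l'
    · refine ⟨a, b, c + 1, by lia, fun x hx y hy z hz => ?_⟩
      rcases hz.lt_or_eq with hz | rfl
      · exact keep x hx y hy z (by lia)
      · obtain ⟨l, v', hl, hvw⟩ := remove x hx y hy c le_rfl
        exact ⟨l, v', by lia, hvw⟩
    · refine ⟨a, b + 1, c, by lia, fun x hx y hy z hz => ?_⟩
      rcases hy.lt_or_eq with hy | rfl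
      · exact keep x hx y (by lia) z hz
      · obtain ⟨l, v', hl, hvw⟩ := remove x hx b le_rfl z hz
        exact ⟨l, v', by lia, hvw⟩
    · refine ⟨a + 1, b, c, by lia, fun x hx y hy z hz => ?_⟩
      rcases hx.lt_or_eq with hx | rfl
      · exact keep x (by lia) y hy z hz
      · obtain ⟨l, v', hl, hvw⟩ := remove a le_rfl y hy z hz
        exact ⟨l, v', by lia, hvw⟩

/-- Among nine disjoint closed subwalks of length at most three, some have total length six. -/
theorem exists_remove_six {A : Fin 3 → Fin 3 → L} {i j : Fin 3} {w : WithOne L}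
    (h : IsWalkWeight A 27 i j w) : ∃ v, IsWalkWeight A 21 i j v ∧ v ∣ w := by
  obtain ⟨a, b, c, hN, habc⟩ := exists_shorten_mul 9 h
  have hsum : ∃ x ≤ a, ∃ y ≤ b, ∃ z ≤ c, x + 2 * y + 3 * z = 6 := by
    have hlarge : 6 ≤ a ∨ 3 ≤ b ∨ 2 ≤ c := by lia
    rcases hlarge with h | h | h
    · exact ⟨6, h, 0, by lia, 0, by lia, rfl⟩
    · exact ⟨0, by lia, 3, h, 0, by lia, rfl⟩
    · exact ⟨0, by lia, 0, by lia, 2, h, rfl⟩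
  obtain ⟨x, hx, y, hy, z, hz, hxyz⟩ := hsum
  obtain ⟨l, v, hl, hv⟩ := habc x hx y hy z hz
  obtain rfl : l = 21 := by lia
  exact ⟨v, hv⟩

end IsWalkWeight

theorem le_of_withOne_dvd {L : Type*} [SemilatticeSup L] [CommSemigroup L]
    (habs : ∀ x y : L, x ⊔ x * y = x) {p q : L} (h : (p : WithOne L) ∣ q) : q ≤ p := by
  obtain ⟨c, hc⟩ := h
  induction c using WithOne.recOneCoe with
  | one => exact (WithOne.coe_inj.mp (by simpa using hc)).le
  | coe x =>
    obtain rfl : q = p * x := WithOne.coe_inj.mp hc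
    exact sup_eq_left.mp (habs p x)

/-- The order-period of any `3 × 3` matrix `A` over a commutative incline
is at most 6: there are positive integers `d ≤ 6` and `k` with `A^(k+d) ≤ A^k` entrywise
(here `A^m = powEntry A (m - 1)` for `m ≥ 1`). -/
theorem order_period_le_six
    {L : Type*} [SemilatticeSup L] [CommSemigroup L]
    (hdist : ∀ x y z : L, x * (y ⊔ z) = x * y ⊔ x * z)
    (habs : ∀ x y : L, x ⊔ x * y = x)
    (A : Fin 3 → Fin 3 → L) :
    ∃ d : ℕ, 0 < d ∧ d ≤ 6 ∧ ∃ k : ℕ, 0 < k ∧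
      ∀ i j : Fin 3, powEntry A (k + d - 1) i j ≤ powEntry A (k - 1) i j := by
  refine ⟨6, by lia, le_rfl, 21, by lia, fun i j => Finset.sup'_le _ _ fun V hV => ?_⟩
  obtain ⟨rfl, rfl⟩ := (Finset.mem_filter.mp hV).2
  obtain ⟨v, hv, hdvd⟩ := (IsWalkWeight.of_walkProd (A := A) V).exists_remove_six
  obtain ⟨U, h0, hl, rfl⟩ := hv.exists_walkProd
  exact (le_of_withOne_dvd habs hdvd).trans
    (Finset.le_sup' (fun V => walkProd A V) (Finset.mem_filter.mpr ⟨Finset.mem_univ U, h0, hl⟩))
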